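/- arXiv:2205.12116 — 2 statements merged into one kernel-verified Lean document; each statement's English description precedes it below -/
import Mathlib

section
/- A morphism g: B ⟶ C of C belongs to S_N if and only if g admits a factorization g = r ∘ l with l ∈ L and r ∈ R a split epimorphism, and this holds if and only if g admits a factorization g = r' ∘ l' with l' ∈ L a split monomorphism and r' ∈ R. (In symbols: S_N = R_sp ∘ L = R ∘ L_sp.) -/
open CategoryTheory CategoryTheory.Limits CategoryTheory.Pretriangulated

universe v u v₂ u₂

variable {C : Type u} [Category.{v} C] [Preadditive C] [HasZeroObject C]
  [HasShift C ℤ] [∀ n : ℤ, (shiftFunctor C n).Additive] [Pretriangulated C]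

/-- `f : X ⟶ Y` factors through an object of `N`. -/
def FactorsThru (N : Set C) {X Y : C} (f : X ⟶ Y) : Prop :=
  ∃ (Z : C) (_ : Z ∈ N) (u : X ⟶ Z) (v : Z ⟶ Y), f = u ≫ v

/-- The morphism `X⟦-1⟧ ⟶ A` obtained from `h : X ⟶ A⟦1⟧` by shifting by `-1` and
composing with the canonical isomorphism `A⟦1⟧⟦-1⟧ ≅ A`. -/
noncomputable def descShift {X A : C} (h : X ⟶ A⟦(1:ℤ)⟧) : X⟦(-1:ℤ)⟧ ⟶ A :=
  h⟦(-1:ℤ)⟧' ≫ (shiftEquiv C (1:ℤ)).unitIso.inv.app A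

/-- The class `S_N` of morphisms fitting in a distinguished triangle whose two other
maps factor through `N`. -/
def SN (N : Set C) {B C₀ : C} (g : B ⟶ C₀) : Prop :=
  ∃ (A : C) (f : A ⟶ B) (h : C₀ ⟶ A⟦(1:ℤ)⟧),
    (Triangle.mk f g h ∈ distTriang C) ∧ FactorsThru N f ∧ FactorsThru N h

/-- The class `L`. -/
def ClassL (N : Set C) {A B : C} (f : A ⟶ B) : Prop :=
  ∃ (N₀ : C) (_ : N₀ ∈ N) (g : B ⟶ N₀) (h : N₀ ⟶ A⟦(1:ℤ)⟧),
    (Triangle.mk f g h ∈ distTriang C) ∧ FactorsThru N (descShift h)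

/-- The class `R`. -/
def ClassR (N : Set C) {B C₀ : C} (g : B ⟶ C₀) : Prop :=
  ∃ (N₀ : C) (_ : N₀ ∈ N) (f : N₀ ⟶ B) (h : C₀ ⟶ N₀⟦(1:ℤ)⟧),
    (Triangle.mk f g h ∈ distTriang C) ∧ FactorsThru N h

/-- Condition (Lex) on a morphism `h : C₀ ⟶ A⟦1⟧`. -/
def LexCond (N : Set C) {C₀ A : C} (h : C₀ ⟶ A⟦(1:ℤ)⟧) : Prop :=
  ∀ (N₀ : C), N₀ ∈ N → ∀ (x : N₀ ⟶ C₀), FactorsThru N (descShift (x ≫ h))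

/-- Condition (Rex) on a morphism `h : C₀ ⟶ A⟦1⟧`. -/
def RexCond (N : Set C) {C₀ A : C} (h : C₀ ⟶ A⟦(1:ℤ)⟧) : Prop :=
  ∀ (N₀ : C), N₀ ∈ N → ∀ (y : A ⟶ N₀),
    ∃ (M : C) (_ : M ∈ N) (u : C₀⟦(-1:ℤ)⟧ ⟶ M⟦(-1:ℤ)⟧) (v : M⟦(-1:ℤ)⟧ ⟶ N₀),
      descShift h ≫ y = u ≫ v

/-- `S_N` as a morphism property. -/
def SNProp (N : Set C) : MorphismProperty C := fun _ _ g => SN N g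

section FactorsThru

variable {N : Set C}

lemma FactorsThru.precomp {X Y Y' : C} {f : X ⟶ Y} (hf : FactorsThru N f) (x : Y' ⟶ X) :
    FactorsThru N (x ≫ f) := by
  obtain ⟨Z, hZ, u, v, rfl⟩ := hf
  exact ⟨Z, hZ, x ≫ u, v, by simp⟩

lemma factorsThru_comp_of_mem {X Y Z : C} (hY : Y ∈ N) (f : X ⟶ Y) (g : Y ⟶ Z) :
    FactorsThru N (f ≫ g) :=
  ⟨Y, hY, f, g, rfl⟩

lemma factorsThru_zero {Z : C} (hZ : Z ∈ N) (X Y : C) : FactorsThru N (0 : X ⟶ Y) :=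
  ⟨Z, hZ, 0, 0, by simp⟩

lemma FactorsThru.add
    (hNext : ∀ T : Triangle C, T ∈ distTriang C → T.obj₁ ∈ N → T.obj₃ ∈ N → T.obj₂ ∈ N)
    {X Y : C} {f g : X ⟶ Y} (hf : FactorsThru N f) (hg : FactorsThru N g) :
    FactorsThru N (f + g) := by
  obtain ⟨Z, hZ, u, v, rfl⟩ := hf
  obtain ⟨Z', hZ', u', v', rfl⟩ := hg
  exact ⟨Z ⊞ Z', hNext _ (binaryBiproductTriangle_distinguished Z Z') hZ hZ',
    biprod.lift u u', biprod.desc v v', by simp⟩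

lemma mem_of_factorsThru_id
    (hNsum : ∀ ⦃X Z : C⦄ (i : X ⟶ Z) (r : Z ⟶ X), i ≫ r = 𝟙 X → Z ∈ N → X ∈ N)
    {X : C} (h : FactorsThru N (𝟙 X)) : X ∈ N := by
  obtain ⟨Z, hZ, u, v, huv⟩ := h
  exact hNsum u v huv.symm hZ

lemma descShift_comp {X P A : C} (h : X ⟶ P⟦(1 : ℤ)⟧) (v : P ⟶ A) :
    descShift (h ≫ v⟦(1 : ℤ)⟧') = descShift h ≫ v := by
  have hv : (v⟦(1 : ℤ)⟧')⟦(-1 : ℤ)⟧' ≫ (shiftEquiv C (1 : ℤ)).unitIso.inv.app A =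
      (shiftEquiv C (1 : ℤ)).unitIso.inv.app P ≫ v :=
    (shiftEquiv C (1 : ℤ)).unitIso.inv.naturality v
  exact (congrArg (· ≫ _) (Functor.map_comp _ _ _)).trans ((Category.assoc _ _ _).trans
    ((congrArg (h⟦(-1 : ℤ)⟧' ≫ ·) hv).trans (Category.assoc _ _ _).symm))

lemma exists_comp_shift_descShift {X A : C} (h : X ⟶ A⟦(1 : ℤ)⟧) :
    ∃ c : X ⟶ (X⟦(-1 : ℤ)⟧)⟦(1 : ℤ)⟧, c ≫ (descShift h)⟦(1 : ℤ)⟧' = h := by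
  have h₁ : ∀ (e : C ≌ C) (k : X ⟶ e.functor.obj A),
      e.counitInv.app X ≫ e.functor.map (e.inverse.map k ≫ e.unitInv.app A) = k := by
    intro e k
    simp
  exact ⟨_, h₁ (shiftEquiv C (1 : ℤ)) h⟩

lemma factorsThru_descShift_iff {X A : C} (h : X ⟶ A⟦(1 : ℤ)⟧) :
    FactorsThru N (descShift h) ↔
      ∃ (P : C) (_ : P ∈ N) (u : X ⟶ P⟦(1 : ℤ)⟧) (v : P ⟶ A), h = u ≫ v⟦(1 : ℤ)⟧' := by
  constructor
  · rintro ⟨P, hP, u, v, huv⟩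
    obtain ⟨c, hc⟩ := exists_comp_shift_descShift h
    refine ⟨P, hP, c ≫ u⟦(1 : ℤ)⟧', v, ?_⟩
    rw [← hc, huv, Functor.map_comp, Category.assoc]
  · rintro ⟨P, hP, u, v, rfl⟩
    rw [descShift_comp]
    exact factorsThru_comp_of_mem hP _ _

end FactorsThru

section Lifting

variable {X Y Z W : C} {f : X ⟶ Y} {g : Y ⟶ Z} {h : Z ⟶ X⟦(1 : ℤ)⟧}

lemma exists_lift_mor₁ (hT : Triangle.mk f g h ∈ distTriang C) (x : W ⟶ Y) (hx : x ≫ g = 0) :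
    ∃ y : W ⟶ X, x = y ≫ f :=
  Triangle.coyoneda_exact₂ _ hT x hx

lemma exists_lift_mor₂ (hT : Triangle.mk f g h ∈ distTriang C) (x : W ⟶ Z) (hx : x ≫ h = 0) :
    ∃ y : W ⟶ Y, x = y ≫ g :=
  Triangle.coyoneda_exact₃ _ hT x hx

lemma exists_desc_mor₂ (hT : Triangle.mk f g h ∈ distTriang C) (x : Y ⟶ W) (hx : f ≫ x = 0) :
    ∃ y : Z ⟶ W, x = g ≫ y :=
  Triangle.yoneda_exact₂ _ hT x hx

lemma exists_desc_mor₃ (hT : Triangle.mk f g h ∈ distTriang C) (x : Z ⟶ W) (hx : g ≫ x = 0) :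
    ∃ y : X⟦(1 : ℤ)⟧ ⟶ W, x = h ≫ y :=
  Triangle.yoneda_exact₃ _ hT x hx

variable {X' Y' Z' : C} {f' : X' ⟶ Y'} {g' : Y' ⟶ Z'} {h' : Z' ⟶ X'⟦(1 : ℤ)⟧}

lemma exists_fill₂ (hT : Triangle.mk f g h ∈ distTriang C)
    (hT' : Triangle.mk f' g' h' ∈ distTriang C) (a : X ⟶ X') (c : Z ⟶ Z')
    (hac : h ≫ a⟦(1 : ℤ)⟧' = c ≫ h') :
    ∃ b : Y ⟶ Y', f ≫ b = a ≫ f' ∧ g ≫ c = b ≫ g' :=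
  complete_distinguished_triangle_morphism₂ _ _ hT hT' a c hac

lemma exists_fill₃ (hT : Triangle.mk f g h ∈ distTriang C)
    (hT' : Triangle.mk f' g' h' ∈ distTriang C) (a : X ⟶ X') (b : Y ⟶ Y')
    (hab : f ≫ b = a ≫ f') :
    ∃ c : Z ⟶ Z', g ≫ c = b ≫ g' ∧ h ≫ a⟦(1 : ℤ)⟧' = c ≫ h' :=
  complete_distinguished_triangle_morphism _ _ hT hT' a b hab

lemma comp_mor₁_mor₂ (hT : Triangle.mk f g h ∈ distTriang C) : f ≫ g = 0 :=
  comp_distTriang_mor_zero₁₂ _ hT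

lemma comp_mor₂_mor₃ (hT : Triangle.mk f g h ∈ distTriang C) : g ≫ h = 0 :=
  comp_distTriang_mor_zero₂₃ _ hT

lemma comp_mor₃_mor₁ (hT : Triangle.mk f g h ∈ distTriang C) : h ≫ f⟦(1 : ℤ)⟧' = 0 :=
  comp_distTriang_mor_zero₃₁ _ hT

lemma exists_lift_descShift (hT : Triangle.mk f g h ∈ distTriang C) (x : W ⟶ X)
    (hx : x ≫ f = 0) : ∃ y : W ⟶ Z⟦(-1 : ℤ)⟧, x = y ≫ descShift h := by
  obtain ⟨y, hy⟩ := Triangle.coyoneda_exact₂ _ (inv_rot_of_distTriang _ hT) x hx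
  exact ⟨-y, hy.trans ((Preadditive.comp_neg y (descShift h)).trans
    (Preadditive.neg_comp y (descShift h)).symm)⟩

lemma rotate_mem_distTriang (hT : Triangle.mk f g h ∈ distTriang C) :
    Triangle.mk g h (-f⟦(1 : ℤ)⟧') ∈ distTriang C :=
  rot_of_distTriang _ hT

/-- A morphism out of the first vertex of a distinguished triangle extends along the first map
as soon as the connecting map kills its shift. -/
lemma exists_extension_mor₁ (hT : Triangle.mk f g h ∈ distTriang C) (x : X ⟶ W)
    (hx : h ≫ x⟦(1 : ℤ)⟧' = 0) : ∃ y : Y ⟶ W, f ≫ y = x := by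
  obtain ⟨y, hy, -⟩ := exists_fill₂ hT (contractible_distinguished W) x 0
    (hx.trans zero_comp.symm)
  exact ⟨y, hy.trans (Category.comp_id x)⟩

end Lifting

section Factorization

variable {N : Set C}
  (hNsum : ∀ ⦃X Z : C⦄ (i : X ⟶ Z) (r : Z ⟶ X), i ≫ r = 𝟙 X → Z ∈ N → X ∈ N)
  (hNext : ∀ T : Triangle C, T ∈ distTriang C → T.obj₁ ∈ N → T.obj₃ ∈ N → T.obj₂ ∈ N)
  {A B C₀ : C}

section Cones

variable {Z M : C} {a : A ⟶ Z} {b : Z ⟶ B} {g : B ⟶ C₀} {p : C₀ ⟶ M} {q : M ⟶ A⟦(1 : ℤ)⟧}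
  (hT : Triangle.mk (a ≫ b) g (p ≫ q) ∈ distTriang C) (hZ : Z ∈ N) (hM : M ∈ N)

include hNsum hNext hT hZ hM

/-- The cone of the first half of a factorization of the first map of an `N`-triangle
lies in `N`. -/
lemma cone_mem {K : C} {i : Z ⟶ K} {k : K ⟶ A⟦(1 : ℤ)⟧}
    (hK : Triangle.mk a i k ∈ distTriang C) : K ∈ N := by
  obtain ⟨E, iE, πE, hE⟩ := distinguished_cocone_triangle₂ (q ≫ a⟦(1 : ℤ)⟧')
  have hEN : E ∈ N := hNext _ hE hZ hM
  obtain ⟨c, -, hc⟩ := exists_fill₃ hK hT (𝟙 A) b (by simp)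
  replace hc : k = c ≫ p ≫ q := by simpa using hc
  obtain ⟨ε, -, hε⟩ := exists_fill₂ hE (rotate_mem_distTriang hK) (𝟙 Z) (-q) (by simp)
  replace hε : πE ≫ (-q) = ε ≫ k := hε
  obtain ⟨κ, hκ⟩ := exists_lift_mor₂ hE (c ≫ p) (by
    have := comp_mor₃_mor₁ hK
    rw [hc] at this
    simpa using this)
  obtain ⟨σ, hσ⟩ := exists_lift_mor₂ (f := a) (g := i) hK (𝟙 K + κ ≫ ε) (by
    rw [Preadditive.add_comp, Category.assoc, ← hε, ← reassoc_of% hκ]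
    simp [hc])
  refine mem_of_factorsThru_id hNsum ?_
  have : 𝟙 K = σ ≫ i + (-κ) ≫ ε := by rw [← hσ]; simp
  rw [this]
  exact (factorsThru_comp_of_mem hZ _ _).add hNext (factorsThru_comp_of_mem hEN _ _)

/-- The fiber of the second half of a factorization of the connecting map of an `N`-triangle
lies in `N`. -/
lemma fiber_mem {Q : C} {i : A ⟶ Q} {j : Q ⟶ M}
    (hQ : Triangle.mk i j q ∈ distTriang C) : Q ∈ N := by
  obtain ⟨E, iE, πE, hE⟩ := distinguished_cocone_triangle₂ (q ≫ a⟦(1 : ℤ)⟧')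
  have hEN : E ∈ N := hNext _ hE hZ hM
  obtain ⟨ε, hε, -⟩ := exists_fill₂ hQ hE a (𝟙 M) (by simp)
  obtain ⟨β, hβ, -⟩ := exists_fill₂ hT hQ (𝟙 A) p (by simp)
  replace hβ : a ≫ b ≫ β = i := by simpa using hβ
  obtain ⟨κ, hκ⟩ := exists_extension_mor₁ hE (b ≫ β) (by
    have := comp_mor₃_mor₁ hQ
    rw [← hβ] at this
    simpa using this)
  obtain ⟨σ, hσ⟩ := exists_desc_mor₂ hQ (𝟙 Q - ε ≫ κ) (by
    rw [Preadditive.comp_sub, reassoc_of% hε, hκ, hβ]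
    simp)
  refine mem_of_factorsThru_id hNsum ?_
  have : 𝟙 Q = j ≫ σ + ε ≫ κ := by rw [← hσ]; simp
  rw [this]
  exact (factorsThru_comp_of_mem hM _ _).add hNext (factorsThru_comp_of_mem hEN _ _)

lemma exists_splitMono_factorization :
    ∃ (B' : C) (l : B ⟶ B') (r : B' ⟶ C₀),
      g = l ≫ r ∧ ClassL N l ∧ IsSplitMono l ∧ ClassR N r := by
  obtain ⟨D, ζ, ρ, hD⟩ := distinguished_cocone_triangle₂ ((p ≫ q) ≫ a⟦(1 : ℤ)⟧')
  obtain ⟨l, hl, hg⟩ := exists_fill₂ hT hD a (𝟙 C₀) (by simp)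
  replace hg : g = l ≫ ρ := by simpa using hg
  have hζρ := comp_mor₁_mor₂ hD
  obtain ⟨t₀, ht₀⟩ := exists_extension_mor₁ hD b (by
    have := comp_mor₃_mor₁ hT
    simpa using this)
  obtain ⟨y₀, hy₀⟩ := exists_desc_mor₂ hT (𝟙 B - l ≫ t₀) (by
    simp [reassoc_of% hl, ht₀])
  have hlt : l ≫ (t₀ + ρ ≫ y₀) = 𝟙 B := by
    rw [Preadditive.comp_add, ← Category.assoc l ρ, ← hg, ← hy₀]
    simp
  have hsm : IsSplitMono l := ⟨⟨⟨_, hlt⟩⟩⟩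
  generalize t₀ + ρ ≫ y₀ = t at hlt
  obtain ⟨K', m, d, hK'⟩ := distinguished_cocone_triangle l
  have hlm := comp_mor₁_mor₂ hK'
  have hd : d = 0 := by
    have h₁ := comp_mor₃_mor₁ hK'
    have h₂ : d ≫ (l ≫ t)⟦(1 : ℤ)⟧' = 0 := by
      rw [Functor.map_comp, reassoc_of% h₁, zero_comp]
    simpa [hlt] using h₂
  obtain ⟨s, hs⟩ := exists_lift_mor₂ hK' (𝟙 K') (by simp [hd])
  obtain ⟨K, i, k, hK⟩ := distinguished_cocone_triangle a
  have hKN : K ∈ N := cone_mem hNsum hNext hT hZ hM hK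
  obtain ⟨κ, hκ⟩ := exists_desc_mor₂ hK (ζ ≫ m) (by
    rw [← reassoc_of% hl, hlm]; simp)
  obtain ⟨θ, hθ, hθk⟩ := exists_fill₂ hD (rotate_mem_distTriang hK) (𝟙 Z) (-(p ≫ q)) (by simp)
  replace hθ : ζ ≫ θ = i := by simpa using hθ
  replace hθk : ρ ≫ (-(p ≫ q)) = θ ≫ k := hθk
  have hai := comp_mor₁_mor₂ hK
  obtain ⟨χ, hχ⟩ := exists_desc_mor₂ hT (l ≫ θ) (by
    simp [reassoc_of% hl, hθ, hai])
  obtain ⟨y, hy⟩ := exists_desc_mor₂ hD (m - (θ - ρ ≫ χ) ≫ κ) (by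
    simp [reassoc_of% hθ, reassoc_of% hζρ, hκ])
  obtain ⟨y', hy'⟩ := exists_desc_mor₃ hT y (by
    rw [hg, Category.assoc, ← hy]
    simp [hlm, reassoc_of% hχ, reassoc_of% hg])
  have hK'N : K' ∈ N := by
    refine mem_of_factorsThru_id hNsum ?_
    have : 𝟙 K' = (s ≫ (θ - ρ ≫ χ)) ≫ κ + (s ≫ θ) ≫ (-(k ≫ y')) := by
      have h₁ : m = (θ - ρ ≫ χ) ≫ κ + θ ≫ (-(k ≫ y')) := by
        rw [Preadditive.comp_neg, ← reassoc_of% hθk, sub_eq_iff_eq_add'.1 hy, hy']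
        simp
      calc
        𝟙 K' = s ≫ m := hs
        _ = _ := by
          conv_lhs => rw [h₁]
          simp only [Preadditive.comp_add, Category.assoc]
    rw [this]
    exact (factorsThru_comp_of_mem hKN _ _).add hNext (factorsThru_comp_of_mem hKN _ _)
  refine ⟨D, l, ρ, hg, ⟨K', hK'N, m, d, hK', ?_⟩, hsm, ⟨Z, hZ, ζ, _, hD, ?_⟩⟩
  · rw [factorsThru_descShift_iff]
    exact ⟨Z, hZ, 0, 0, by simp [hd]⟩
  · exact ⟨M, hM, p, q ≫ a⟦(1 : ℤ)⟧', by simp⟩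

lemma exists_splitEpi_factorization :
    ∃ (B' : C) (l : B ⟶ B') (r : B' ⟶ C₀),
      g = l ≫ r ∧ ClassL N l ∧ ClassR N r ∧ IsSplitEpi r := by
  obtain ⟨D, l, ω, hD⟩ := distinguished_cocone_triangle₂ (q ≫ (a ≫ b)⟦(1 : ℤ)⟧')
  obtain ⟨r, hr, hrh⟩ := exists_fill₂ hD (rotate_mem_distTriang hT) (𝟙 B) (-q) (by simp)
  replace hr : l ≫ r = g := by simpa using hr
  replace hrh : ω ≫ (-q) = r ≫ p ≫ q := hrh
  have hlω := comp_mor₁_mor₂ hD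
  obtain ⟨σ₀, hσ₀⟩ := exists_lift_mor₂ hD (-p) (by
    have := comp_mor₃_mor₁ hT
    simpa using this)
  obtain ⟨y₀, hy₀⟩ := exists_lift_mor₂ hT (𝟙 C₀ - σ₀ ≫ r) (by
    rw [Preadditive.sub_comp, Category.assoc, ← hrh, ← reassoc_of% hσ₀]
    simp)
  have hσr : (σ₀ + y₀ ≫ l) ≫ r = 𝟙 C₀ := by
    rw [Preadditive.add_comp, Category.assoc y₀, hr, ← hy₀]
    simp
  have hse : IsSplitEpi r := ⟨⟨⟨_, hσr⟩⟩⟩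
  generalize σ₀ + y₀ ≫ l = σ at hσr
  obtain ⟨K', s, d, hK'⟩ := distinguished_cocone_triangle₁ r
  have hsr := comp_mor₁_mor₂ hK'
  have hd : d = 0 := by
    have h₁ := comp_mor₂_mor₃ hK'
    rw [← Category.id_comp d, ← hσr, Category.assoc, h₁, comp_zero]
  obtain ⟨m, hm⟩ := exists_extension_mor₁ hK' (𝟙 K') (by simp [hd])
  obtain ⟨Q, i, j, hQ⟩ := distinguished_cocone_triangle₂ q
  have hQN : Q ∈ N := fiber_mem hNsum hNext hT hZ hM hQ
  have hjq := comp_mor₂_mor₃ hQ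
  obtain ⟨κ, hκ⟩ := exists_lift_mor₂ hQ (s ≫ ω) (by
    have : s ≫ ω ≫ (-q) = 0 := by rw [hrh, reassoc_of% hsr, zero_comp]
    simpa using this)
  obtain ⟨θ, hθ, hθω⟩ := exists_fill₂ hQ hD (a ≫ b) (𝟙 M) (by simp)
  replace hθω : j = θ ≫ ω := by simpa using hθω
  obtain ⟨χ, hχ⟩ := exists_lift_mor₂ hT (θ ≫ r) (by
    rw [Category.assoc, ← hrh, ← reassoc_of% hθω]
    simp [hjq])
  obtain ⟨y, hy⟩ := exists_lift_mor₁ hD (s - κ ≫ (θ - χ ≫ l)) (by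
    simp [hlω, ← hθω, hκ])
  obtain ⟨y', hy'⟩ := exists_lift_mor₁ hT y (by
    rw [← hr, ← Category.assoc, ← hy]
    simp [hsr, hχ, hr])
  have hK'N : K' ∈ N := by
    refine mem_of_factorsThru_id hNsum ?_
    have : 𝟙 K' = κ ≫ ((θ - χ ≫ l) ≫ m) + (y' ≫ i) ≫ (θ ≫ m) := by
      have h₁ : s = κ ≫ (θ - χ ≫ l) + (y' ≫ i) ≫ θ := by
        rw [Category.assoc y', hθ, sub_eq_iff_eq_add'.1 hy, hy']
        simp
      calc
        𝟙 K' = s ≫ m := hm.symm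
        _ = _ := by
          conv_lhs => rw [h₁]
          simp only [Preadditive.add_comp, Category.assoc]
    rw [this]
    exact (factorsThru_comp_of_mem hQN _ _).add hNext (factorsThru_comp_of_mem hQN _ _)
  refine ⟨D, l, r, hr.symm, ⟨M, hM, ω, _, hD, ?_⟩, ⟨K', hK'N, s, d, hK', ?_⟩, hse⟩
  · rw [factorsThru_descShift_iff]
    exact ⟨Z, hZ, q ≫ a⟦(1 : ℤ)⟧', b, by simp⟩
  · rw [hd]
    exact factorsThru_zero hZ _ _

end Cones

include hNext

lemma SN.of_comp_splitEpi {B' : C} {l : B ⟶ B'} {r : B' ⟶ C₀}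
    (hl : ClassL N l) (hr : ClassR N r) [IsSplitEpi r] : SN N (l ≫ r) := by
  obtain ⟨N', hN', m, e, hL, he⟩ := hl
  rw [factorsThru_descShift_iff] at he
  obtain ⟨P, hP, e₁, e₂, rfl⟩ := he
  obtain ⟨M, hM, j, d, hR, -⟩ := hr
  obtain ⟨A, f, h, hT⟩ := distinguished_cocone_triangle₁ (l ≫ r)
  have hfg := comp_mor₁_mor₂ hT
  have hlm := comp_mor₁_mor₂ hL
  refine ⟨A, f, h, hT, ?_, ?_⟩
  · obtain ⟨φ, hφ⟩ := exists_lift_mor₁ hR (f ≫ l) (by simpa using hfg)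
    obtain ⟨V, iV, πV, hV⟩ := distinguished_cocone_triangle₂ e₁
    obtain ⟨W, iW, ω, hW⟩ := distinguished_cocone_triangle₂ ((j ≫ m) ≫ e₁)
    have hWN : W ∈ N := hNext _ hW hP hM
    obtain ⟨v, hv, hvm⟩ := exists_fill₂ hV hL e₂ (𝟙 N') (by simp)
    replace hvm : πV = v ≫ m := by simpa using hvm
    have hωe := comp_mor₂_mor₃ hW
    obtain ⟨τ, hτ⟩ := exists_lift_mor₂ hV (ω ≫ j ≫ m) (by simpa using hωe)
    obtain ⟨β, hβ⟩ := exists_lift_mor₁ hL (ω ≫ j - τ ≫ v) (by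
      simp [← hvm, ← hτ])
    have hφm : φ ≫ j ≫ m = 0 := by
      rw [← reassoc_of% hφ, hlm, comp_zero]
    obtain ⟨α, hα⟩ := exists_lift_mor₂ hW φ (by
      simp [reassoc_of% hφm])
    obtain ⟨π, hπ⟩ := exists_lift_mor₁ hV (α ≫ τ) (by
      rw [Category.assoc, ← hτ, ← reassoc_of% hα, hφm])
    obtain ⟨γ, hγ⟩ := exists_lift_descShift hL (f - α ≫ β - π ≫ e₂) (by
      rw [Preadditive.sub_comp, Preadditive.sub_comp, Category.assoc, Category.assoc, ← hβ,
        ← hv, ← reassoc_of% hπ, hφ, hα]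
      simp)
    have he : FactorsThru N (f - α ≫ β - π ≫ e₂) := by
      rw [hγ]
      exact ((factorsThru_descShift_iff _).2 ⟨P, hP, e₁, e₂, rfl⟩).precomp _
    have : f = (f - α ≫ β - π ≫ e₂) + (α ≫ β + π ≫ e₂) := by abel
    rw [this]
    exact he.add hNext ((factorsThru_comp_of_mem hWN _ _).add hNext
      (factorsThru_comp_of_mem hP _ _))
  · have hgh := comp_mor₂_mor₃ hT
    obtain ⟨ψ, hψ⟩ := exists_desc_mor₂ hL (r ≫ h) (by simpa using hgh)
    have : h = (section_ r ≫ m) ≫ ψ := by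
      rw [Category.assoc, ← hψ, IsSplitEpi.id_assoc]
    rw [this]
    exact factorsThru_comp_of_mem hN' _ _

lemma SN.of_splitMono_comp {B' : C} {l : B ⟶ B'} {r : B' ⟶ C₀}
    (hl : ClassL N l) [IsSplitMono l] (hr : ClassR N r) : SN N (l ≫ r) := by
  obtain ⟨N', hN', m, e, hL, -⟩ := hl
  obtain ⟨N₀, hN₀, ν, d, hR, P, hP, d₁, d₂, rfl⟩ := hr
  obtain ⟨A, f, h, hT⟩ := distinguished_cocone_triangle₁ (l ≫ r)
  have hfg := comp_mor₁_mor₂ hT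
  have hgh := comp_mor₂_mor₃ hT
  have hνr := comp_mor₁_mor₂ hR
  refine ⟨A, f, h, hT, ?_, ?_⟩
  · obtain ⟨φ, hφ⟩ := exists_lift_mor₁ hR (f ≫ l) (by simpa using hfg)
    have : f = φ ≫ ν ≫ retraction l := by
      rw [← reassoc_of% hφ, IsSplitMono.id, Category.comp_id]
    rw [this]
    exact factorsThru_comp_of_mem hN₀ _ _
  · obtain ⟨ψ, hψ⟩ := exists_desc_mor₂ hL (r ≫ h) (by simpa using hgh)
    have hνψ : ν ≫ m ≫ ψ = 0 := by rw [← hψ, reassoc_of% hνr, zero_comp]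
    obtain ⟨V, iV, πV, hV⟩ := distinguished_cocone_triangle₂ d₂
    obtain ⟨W, ω, πW, hW⟩ := distinguished_cocone_triangle₂ (d₂ ≫ (ν ≫ m)⟦(1 : ℤ)⟧')
    have hWN : W ∈ N := hNext _ hW hN' hP
    obtain ⟨v, hv, hvπ⟩ := exists_fill₂ hR hV (𝟙 N₀) d₁ (by simp)
    replace hv : ν ≫ v = iV := by simpa using hv
    obtain ⟨τ, hτ, -⟩ := exists_fill₂ hV hW (ν ≫ m) (𝟙 P) (by simp)
    obtain ⟨β, hβ⟩ := exists_desc_mor₂ hR (m ≫ ω - v ≫ τ) (by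
      rw [Preadditive.comp_sub, reassoc_of% hv, hτ]
      simp)
    obtain ⟨α, hα⟩ := exists_extension_mor₁ hW ψ (by
      rw [Category.assoc, ← Functor.map_comp, Category.assoc, hνψ]
      simp)
    obtain ⟨π, hπ⟩ := exists_desc_mor₂ hV (τ ≫ α) (by
      rw [reassoc_of% hτ, hα, hνψ])
    obtain ⟨γ, hγ⟩ := exists_desc_mor₃ hR (h - β ≫ α - d₁ ≫ π) (by
      rw [Preadditive.comp_sub, Preadditive.comp_sub, ← reassoc_of% hβ, reassoc_of% hvπ, ← hπ,
        hψ]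
      simp [hα])
    have : h = (d₁ ≫ d₂) ≫ γ + (β ≫ α + d₁ ≫ π) := by rw [← hγ]; abel
    rw [this]
    refine FactorsThru.add hNext ?_ ((factorsThru_comp_of_mem hWN _ _).add hNext
      (factorsThru_comp_of_mem hP _ _))
    rw [Category.assoc]
    exact factorsThru_comp_of_mem hP _ _

end Factorization

theorem stmt5 (N : Set C)
    (hN0 : ∀ X : C, Limits.IsZero X → X ∈ N)
    (hNiso : ∀ ⦃X Y : C⦄, (X ≅ Y) → X ∈ N → Y ∈ N)
    (hNsum : ∀ ⦃X Z : C⦄ (i : X ⟶ Z) (r : Z ⟶ X), i ≫ r = 𝟙 X → Z ∈ N → X ∈ N)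
    (hNext : ∀ (T : Triangle C), (T ∈ distTriang C) → T.obj₁ ∈ N → T.obj₃ ∈ N → T.obj₂ ∈ N)
    {B C₀ : C} (g : B ⟶ C₀) :
    (SN N g ↔ ∃ (B' : C) (l : B ⟶ B') (r : B' ⟶ C₀),
        g = l ≫ r ∧ ClassL N l ∧ ClassR N r ∧ IsSplitEpi r) ∧
    (SN N g ↔ ∃ (B' : C) (l : B ⟶ B') (r : B' ⟶ C₀),
        g = l ≫ r ∧ ClassL N l ∧ IsSplitMono l ∧ ClassR N r) := by
  refine ⟨⟨?_, ?_⟩, ⟨?_, ?_⟩⟩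
  · rintro ⟨A, _, _, hT, ⟨Z, hZ, a, b, rfl⟩, ⟨M, hM, p, q, rfl⟩⟩
    exact exists_splitEpi_factorization hNsum hNext hT hZ hM
  · rintro ⟨B', l, r, rfl, hl, hr, _⟩
    exact SN.of_comp_splitEpi hNext hl hr
  · rintro ⟨A, _, _, hT, ⟨Z, hZ, a, b, rfl⟩, ⟨M, hM, p, q, rfl⟩⟩
    exact exists_splitMono_factorization hNsum hNext hT hZ hM
  · rintro ⟨B', l, r, rfl, hl, _, hr⟩
    exact SN.of_splitMono_comp hNext hl hr
end

section
/- For any morphism f: X ⟶ Y in C, Q(f) = 0 in D if and only if f factors through an object of N. -/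
open CategoryTheory CategoryTheory.Limits CategoryTheory.Pretriangulated

universe v u v₂ u₂

variable {C : Type u} [Category.{v} C] [Preadditive C] [HasZeroObject C]
  [HasShift C ℤ] [∀ n : ℤ, (shiftFunctor C n).Additive] [Pretriangulated C]

namespace CategoryTheory.Pretriangulated

section

variable {A B E : C} {f : A ⟶ B} {g : B ⟶ E} {h : E ⟶ A⟦(1 : ℤ)⟧}

lemma comp_eq_zero₁₂ (hT : Triangle.mk f g h ∈ distTriang C) :
    f ≫ g = 0 :=
  comp_distTriang_mor_zero₁₂ _ hT

lemma comp_eq_zero₂₃ (hT : Triangle.mk f g h ∈ distTriang C) :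
    g ≫ h = 0 :=
  comp_distTriang_mor_zero₂₃ _ hT

lemma comp_eq_zero₃₁ (hT : Triangle.mk f g h ∈ distTriang C) :
    h ≫ f⟦(1 : ℤ)⟧' = 0 :=
  comp_distTriang_mor_zero₃₁ _ hT

lemma exists_lift₁ (hT : Triangle.mk f g h ∈ distTriang C)
    {X : C} (x : X ⟶ A⟦(1 : ℤ)⟧) (hx : x ≫ f⟦(1 : ℤ)⟧' = 0) :
    ∃ y : X ⟶ E, x = y ≫ h :=
  Triangle.coyoneda_exact₁ _ hT x hx

lemma exists_lift₂ (hT : Triangle.mk f g h ∈ distTriang C)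
    {X : C} (x : X ⟶ B) (hx : x ≫ g = 0) : ∃ y : X ⟶ A, x = y ≫ f :=
  Triangle.coyoneda_exact₂ _ hT x hx

lemma exists_lift₃ (hT : Triangle.mk f g h ∈ distTriang C)
    {X : C} (x : X ⟶ E) (hx : x ≫ h = 0) : ∃ y : X ⟶ B, x = y ≫ g :=
  Triangle.coyoneda_exact₃ _ hT x hx

lemma exists_desc₂ (hT : Triangle.mk f g h ∈ distTriang C)
    {X : C} (x : B ⟶ X) (hx : f ≫ x = 0) : ∃ y : E ⟶ X, x = g ≫ y :=
  Triangle.yoneda_exact₂ _ hT x hx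

lemma exists_desc₃ (hT : Triangle.mk f g h ∈ distTriang C)
    {X : C} (x : E ⟶ X) (hx : g ≫ x = 0) :
    ∃ y : A⟦(1 : ℤ)⟧ ⟶ X, x = h ≫ y :=
  Triangle.yoneda_exact₃ _ hT x hx

variable {A' B' E' : C} {f' : A' ⟶ B'} {g' : B' ⟶ E'} {h' : E' ⟶ A'⟦(1 : ℤ)⟧}

lemma exists_map₂ (hT : Triangle.mk f g h ∈ distTriang C)
    (hT' : Triangle.mk f' g' h' ∈ distTriang C)
    (a : A ⟶ A') (c : E ⟶ E') (comm : h ≫ a⟦(1 : ℤ)⟧' = c ≫ h') :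
    ∃ b : B ⟶ B', f ≫ b = a ≫ f' ∧ g ≫ c = b ≫ g' :=
  complete_distinguished_triangle_morphism₂ _ _ hT hT' a c comm

lemma exists_map₃ (hT : Triangle.mk f g h ∈ distTriang C)
    (hT' : Triangle.mk f' g' h' ∈ distTriang C)
    (a : A ⟶ A') (b : B ⟶ B') (comm : f ≫ b = a ≫ f') :
    ∃ c : E ⟶ E', g ≫ c = b ≫ g' ∧ h ≫ a⟦(1 : ℤ)⟧' = c ≫ h' :=
  complete_distinguished_triangle_morphism _ _ hT hT' a b comm

end

open ZeroObject in
lemma exists_desc₁ {A B E : C} {f : A ⟶ B} {g : B ⟶ E} {h : E ⟶ A⟦(1 : ℤ)⟧}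
    (hT : Triangle.mk f g h ∈ distTriang C) {X : C} (x : A ⟶ X) (hx : h ≫ x⟦(1 : ℤ)⟧' = 0) :
    ∃ y : B ⟶ X, f ≫ y = x := by
  obtain ⟨y, hy, -⟩ := exists_map₂ hT (contractible_distinguished X) x 0 (by simp [hx])
  exact ⟨y, by simpa using hy⟩

end CategoryTheory.Pretriangulated

namespace FactorsThru

variable {N : Set C}

set_option linter.unusedSectionVars false in
lemma comp_left {W X Y : C} (a : W ⟶ X) {f : X ⟶ Y} (hf : FactorsThru N f) :
    FactorsThru N (a ≫ f) := by
  obtain ⟨Z, hZ, u, v, rfl⟩ := hf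
  exact ⟨Z, hZ, a ≫ u, v, by simp⟩

set_option linter.unusedSectionVars false in
lemma comp_right {X Y Z : C} {f : X ⟶ Y} (hf : FactorsThru N f) (a : Y ⟶ Z) :
    FactorsThru N (f ≫ a) := by
  obtain ⟨Z, hZ, u, v, rfl⟩ := hf
  exact ⟨Z, hZ, u, v ≫ a, by simp⟩

set_option linter.unusedSectionVars false in
lemma neg {X Y : C} {f : X ⟶ Y} (hf : FactorsThru N f) : FactorsThru N (-f) := by
  obtain ⟨Z, hZ, u, v, rfl⟩ := hf
  exact ⟨Z, hZ, -u, v, by simp⟩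

open ZeroObject in
set_option linter.unusedSectionVars false in
lemma zero (hN0 : ∀ X : C, IsZero X → X ∈ N) (X Y : C) : FactorsThru N (0 : X ⟶ Y) :=
  ⟨0, hN0 _ (isZero_zero C), 0, 0, by simp⟩

lemma add_s8 (hNext : ∀ T : Triangle C, T ∈ distTriang C → T.obj₁ ∈ N → T.obj₃ ∈ N → T.obj₂ ∈ N)
    {X Y : C} {f g : X ⟶ Y} (hf : FactorsThru N f) (hg : FactorsThru N g) :
    FactorsThru N (f + g) := by
  obtain ⟨Z, hZ, u, v, rfl⟩ := hf
  obtain ⟨Z', hZ', u', v', rfl⟩ := hg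
  exact ⟨Z ⊞ Z', hNext _ (binaryBiproductTriangle_distinguished Z Z') hZ hZ',
    biprod.lift u u', biprod.desc v v', by simp⟩

lemma sub (hNext : ∀ T : Triangle C, T ∈ distTriang C → T.obj₁ ∈ N → T.obj₃ ∈ N → T.obj₂ ∈ N)
    {X Y : C} {f g : X ⟶ Y} (hf : FactorsThru N f) (hg : FactorsThru N g) :
    FactorsThru N (f - g) := by
  rw [sub_eq_add_neg]
  exact hf.add_s8 hNext hg.neg

/-- A morphism out of the middle object of a distinguished triangle with third object in `N`
factors through `N` as soon as its restriction to the first object does. -/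
lemma of_mor₁_comp
    (hNext : ∀ T : Triangle C, T ∈ distTriang C → T.obj₁ ∈ N → T.obj₃ ∈ N → T.obj₂ ∈ N)
    {A E Z B : C} {a : A ⟶ E} {b : E ⟶ Z} {z : Z ⟶ A⟦(1 : ℤ)⟧}
    (hT : Triangle.mk a b z ∈ distTriang C) (hZ : Z ∈ N) {e : E ⟶ B}
    (he : FactorsThru N (a ≫ e)) : FactorsThru N e := by
  obtain ⟨M, hM, p, q, hpq⟩ := he
  obtain ⟨E', m, n, hT'⟩ := distinguished_cocone_triangle₂ (z ≫ p⟦(1 : ℤ)⟧')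
  obtain ⟨t, ht, -⟩ := exists_map₂ hT hT' p (𝟙 Z) (by simp)
  have hza : z ≫ a⟦(1 : ℤ)⟧' = 0 := comp_eq_zero₃₁ hT
  obtain ⟨y, hy⟩ := exists_desc₁ hT' q (by
    rw [Category.assoc, ← Functor.map_comp, ← hpq, Functor.map_comp, reassoc_of% hza, zero_comp])
  obtain ⟨w, hw⟩ := exists_desc₂ hT (t ≫ y - e) (by
    rw [Preadditive.comp_sub, reassoc_of% ht, hy, hpq, sub_self])
  have hE' : FactorsThru N (t ≫ y) := ⟨E', hNext _ hT' hM hZ, t, y, rfl⟩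
  have hbw : FactorsThru N (b ≫ w) := ⟨Z, hZ, b, w, rfl⟩
  rw [← sub_sub_cancel (t ≫ y) e, hw]
  exact hE'.sub hNext hbw

/-- A morphism to the middle object of a distinguished triangle with first object in `N`
factors through `N` as soon as its composition to the third object does. -/
lemma of_comp_mor₂
    (hNext : ∀ T : Triangle C, T ∈ distTriang C → T.obj₁ ∈ N → T.obj₃ ∈ N → T.obj₂ ∈ N)
    {Z E A B : C} {a : Z ⟶ E} {b : E ⟶ A} {z : A ⟶ Z⟦(1 : ℤ)⟧}
    (hT : Triangle.mk a b z ∈ distTriang C) (hZ : Z ∈ N) {e : B ⟶ E}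
    (he : FactorsThru N (e ≫ b)) : FactorsThru N e := by
  obtain ⟨M, hM, u, v, huv⟩ := he
  obtain ⟨E', m, n, hT'⟩ := distinguished_cocone_triangle₂ (v ≫ z)
  obtain ⟨t, -, ht⟩ := exists_map₂ hT' hT (𝟙 Z) v (by simp)
  have hbz : b ≫ z = 0 := comp_eq_zero₂₃ hT
  obtain ⟨e', he'⟩ := exists_lift₃ hT' u (by
    rw [← Category.assoc, ← huv, Category.assoc, hbz, comp_zero])
  obtain ⟨w, hw⟩ := exists_lift₂ hT (e' ≫ t - e) (by
    rw [Preadditive.sub_comp, Category.assoc, ← ht, huv, he', Category.assoc, sub_self])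
  have hE' : FactorsThru N (e' ≫ t) := ⟨E', hNext _ hT' hZ hM, e', t, rfl⟩
  have hwa : FactorsThru N (w ≫ a) := ⟨Z, hZ, w, a, rfl⟩
  rw [← sub_sub_cancel (e' ≫ t) e, hw]
  exact hE'.sub hNext hwa

end FactorsThru

namespace SN

variable {N : Set C}

/-- Morphisms in `S_N` are monomorphisms modulo `N`. -/
lemma factorsThru_of_comp_right
    (hNext : ∀ T : Triangle C, T ∈ distTriang C → T.obj₁ ∈ N → T.obj₃ ∈ N → T.obj₂ ∈ N)
    {X B C₀ : C} {g : B ⟶ C₀} (hg : SN N g) {x : X ⟶ B} (hx : FactorsThru N (x ≫ g)) :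
    FactorsThru N x := by
  obtain ⟨A, f, h, hT, hf, -⟩ := hg
  obtain ⟨Z, hZ, u, v, huv⟩ := hx
  obtain ⟨E, a, b, hT'⟩ := distinguished_cocone_triangle₂ (v ≫ h)
  obtain ⟨e, hae, hbv⟩ :=
    exists_map₂ hT' hT (𝟙 A) v (by simp)
  rw [Category.id_comp] at hae
  have hgh : g ≫ h = 0 := comp_eq_zero₂₃ hT
  have he : FactorsThru N e := .of_mor₁_comp hNext hT' hZ (hae ▸ hf)
  obtain ⟨l, hl⟩ := exists_lift₃ hT' u (by
    rw [← Category.assoc, ← huv, Category.assoc, hgh, comp_zero])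
  obtain ⟨w, hw⟩ := exists_lift₂ hT (x - l ≫ e) (by
    rw [Preadditive.sub_comp, Category.assoc, ← hbv, huv, hl, Category.assoc, sub_self])
  rw [← sub_add_cancel x (l ≫ e), hw]
  exact (hf.comp_left w).add_s8 hNext (he.comp_left l)

/-- Morphisms in `S_N` are epimorphisms modulo `N`. -/
lemma factorsThru_of_comp_left
    (hNext : ∀ T : Triangle C, T ∈ distTriang C → T.obj₁ ∈ N → T.obj₃ ∈ N → T.obj₂ ∈ N)
    {B C₀ Y : C} {g : B ⟶ C₀} (hg : SN N g) {x : C₀ ⟶ Y} (hx : FactorsThru N (g ≫ x)) :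
    FactorsThru N x := by
  obtain ⟨A, f, h, hT, -, hh⟩ := hg
  obtain ⟨Z, hZ, u, v, huv⟩ := hx
  obtain ⟨E, a, b, hT'⟩ := distinguished_cocone_triangle (f ≫ u)
  obtain ⟨e, hge, heb⟩ :=
    exists_map₃ hT hT' (𝟙 A) u (by simp)
  rw [CategoryTheory.Functor.map_id, Category.comp_id] at heb
  have hfg : f ≫ g = 0 := comp_eq_zero₁₂ hT
  have he : FactorsThru N e :=
    .of_comp_mor₂ hNext (rot_of_distTriang _ hT') hZ (e := e) (by
      change FactorsThru N (e ≫ b)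
      rwa [← heb])
  obtain ⟨y, hy⟩ := exists_desc₂ hT' v (by
    rw [Category.assoc, ← huv, reassoc_of% hfg, zero_comp])
  obtain ⟨w, hw⟩ := exists_desc₃ hT (x - e ≫ y) (by
    rw [Preadditive.comp_sub, huv, reassoc_of% hge, ← hy, sub_self])
  rw [← sub_add_cancel x (e ≫ y), hw]
  exact (hh.comp_right w).add_s8 hNext (he.comp_right y)

/-- The right Ore condition holds for `S_N` modulo `N`. -/
lemma exists_ore
    (hNsum : ∀ ⦃X Z : C⦄ (i : X ⟶ Z) (r : Z ⟶ X), i ≫ r = 𝟙 X → Z ∈ N → X ∈ N)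
    (hNext : ∀ T : Triangle C, T ∈ distTriang C → T.obj₁ ∈ N → T.obj₃ ∈ N → T.obj₂ ∈ N)
    {B C₀ C₁ : C} {g : B ⟶ C₀} (hg : SN N g) (c : C₁ ⟶ C₀) :
    ∃ (B₁ : C) (s : B₁ ⟶ C₁) (b : B₁ ⟶ B), SN N s ∧ FactorsThru N (s ≫ c - b ≫ g) := by
  obtain ⟨A, f, h, hT, ⟨M, hM, p, q, rfl⟩, hh⟩ := hg
  obtain ⟨K, i, d, hK⟩ := distinguished_cocone_triangle p
  obtain ⟨k, -, hkh⟩ :=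
    exists_map₃ hK hT (𝟙 A) q (by simp)
  rw [CategoryTheory.Functor.map_id, Category.comp_id] at hkh
  have hKid : FactorsThru N (𝟙 K) :=
    .of_comp_mor₂ hNext (rot_of_distTriang _ hK) hM (e := 𝟙 K) (by
      change FactorsThru N (𝟙 K ≫ d)
      rw [hkh]
      exact (hh.comp_left k).comp_left _)
  obtain ⟨Z, hZ, j, r, hjr⟩ := hKid
  have hKN : K ∈ N := hNsum j r hjr.symm hZ
  obtain ⟨B₁, m, s, hs⟩ := distinguished_cocone_triangle₂ (c ≫ h ≫ p⟦(1 : ℤ)⟧')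
  have hs₀ : s ≫ c ≫ h ≫ p⟦(1 : ℤ)⟧' = 0 := comp_eq_zero₂₃ hs
  obtain ⟨κ, hκ⟩ := exists_lift₁ hK (s ≫ c ≫ h) (by simpa using hs₀)
  obtain ⟨b, hb⟩ := exists_lift₃ hT (s ≫ c - κ ≫ k) (by
    rw [Preadditive.sub_comp, Category.assoc, Category.assoc, hκ, hkh, sub_self])
  refine ⟨B₁, s, b, ⟨M, m, _, hs, ⟨M, hM, 𝟙 M, m, by simp⟩,
    (hh.comp_right _).comp_left c⟩, ⟨K, hKN, κ, k, ?_⟩⟩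
  rw [← hb, sub_sub_cancel]

open ZeroObject in
/-- The zero morphism to an object of `N` belongs to `S_N`. -/
lemma zero_to (hN0 : ∀ X : C, IsZero X → X ∈ N) {Z : C} (hZ : Z ∈ N) :
    SN N (0 : (0 : C) ⟶ Z) := by
  obtain ⟨A, f, h, hT⟩ := distinguished_cocone_triangle₁ (0 : (0 : C) ⟶ Z)
  exact ⟨A, f, h, hT, ⟨0, hN0 _ (isZero_zero C), f, 𝟙 _, by rw [Category.comp_id]⟩,
    ⟨Z, hZ, 𝟙 _, h, by simp⟩⟩

end SN

namespace CategoryTheory.MorphismProperty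

/-- If a class of monomorphisms satisfies the right Ore condition, then its multiplicative closure
has a right calculus of fractions. -/
lemma multiplicativeClosure_hasRightCalculusOfFractions {E : Type*} [Category* E]
    (W : MorphismProperty E) (hmono : W ≤ monomorphisms E)
    (hore : ∀ ⦃X Y Y' : E⦄ (s : X ⟶ Y) (c : Y' ⟶ Y), W s →
      ∃ (X' : E) (s' : X' ⟶ Y') (c' : X' ⟶ X), W s' ∧ s' ≫ c = c' ≫ s) :
    W.multiplicativeClosure.HasRightCalculusOfFractions where
  exists_rightFraction := by
    rintro X Y ⟨f, s, hs⟩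
    suffices ∃ (X' : E) (s' : X' ⟶ X) (f' : X' ⟶ Y),
        W.multiplicativeClosure s' ∧ s' ≫ f = f' ≫ s by
      obtain ⟨X', s', f', hs', fac⟩ := this
      exact ⟨⟨s', hs', f'⟩, fac⟩
    induction hs generalizing X with
    | of s hs =>
      obtain ⟨X', s', f', hs', fac⟩ := hore s f hs
      exact ⟨X', s', f', .of _ hs', fac⟩
    | id => exact ⟨X, 𝟙 X, f, .id X, by simp⟩
    | comp_of s t _ ht ih =>
      obtain ⟨X', t', f', ht', fac⟩ := hore t f ht
      obtain ⟨X'', s', f'', hs', fac'⟩ := ih f'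
      exact ⟨X'', s' ≫ t', f'', comp_mem _ _ _ hs' (.of _ ht'), by
        rw [Category.assoc, fac, reassoc_of% fac']⟩
  ext := by
    intro X Y Z f₁ f₂ s hs h
    have : Mono s := multiplicativeClosure_le_iff W (monomorphisms E) |>.2 hmono _ hs
    exact ⟨X, 𝟙 X, .id X, by rw [(cancel_mono s).1 h]⟩

end CategoryTheory.MorphismProperty

/-- Two parallel morphisms are related when their difference factors through `N`. -/
def factorsThruHomRel (N : Set C) : HomRel C := fun _ _ f g => FactorsThru N (f - g)

lemma factorsThruHomRel_congruence {N : Set C} (hN0 : ∀ X : C, IsZero X → X ∈ N)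
    (hNext : ∀ T : Triangle C, T ∈ distTriang C → T.obj₁ ∈ N → T.obj₃ ∈ N → T.obj₂ ∈ N) :
    Congruence (factorsThruHomRel N) where
  equivalence :=
    { refl f := by
        simpa [factorsThruHomRel] using FactorsThru.zero hN0 _ _
      symm h := by
        simpa [factorsThruHomRel] using h.neg
      trans h₁ h₂ := by
        simpa [factorsThruHomRel] using h₁.add_s8 hNext h₂ }
  comp_left f _ _ h := by
    simpa [factorsThruHomRel] using h.comp_left f
  comp_right g h := by
    simpa [factorsThruHomRel] using h.comp_right g

lemma factorsThru_of_map_eq_zero {N : Set C} (hN0 : ∀ X : C, IsZero X → X ∈ N)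
    (hNsum : ∀ ⦃X Z : C⦄ (i : X ⟶ Z) (r : Z ⟶ X), i ≫ r = 𝟙 X → Z ∈ N → X ∈ N)
    (hNext : ∀ T : Triangle C, T ∈ distTriang C → T.obj₁ ∈ N → T.obj₃ ∈ N → T.obj₂ ∈ N)
    {D : Type u₂} [Category.{v₂} D] [Preadditive D]
    (Q : C ⥤ D) [Q.Additive] [Q.IsLocalization (SNProp N)]
    {X Y : C} {f : X ⟶ Y} (hf : Q.map f = 0) : FactorsThru N f := by
  have := factorsThruHomRel_congruence hN0 hNext
  let π := Quotient.functor (factorsThruHomRel N)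
  have π_eq {X Y : C} (f g : X ⟶ Y) : π.map f = π.map g ↔ FactorsThru N (f - g) :=
    Quotient.functor_map_eq_iff _ f g
  let W := (SNProp N).strictMap π
  have hmono : W ≤ .monomorphisms _ := by
    rintro _ _ _ ⟨hs⟩
    refine ⟨fun {X} a b hab => ?_⟩
    obtain ⟨a, rfl⟩ := π.map_surjective (X := X.as) a
    obtain ⟨b, rfl⟩ := π.map_surjective (X := X.as) b
    rw [← π.map_comp, ← π.map_comp, π_eq, ← Preadditive.sub_comp] at hab
    exact (π_eq _ _).2 (SN.factorsThru_of_comp_right hNext hs hab)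
  have hepi : W ≤ .epimorphisms _ := by
    rintro _ _ _ ⟨hs⟩
    refine ⟨fun {X} a b hab => ?_⟩
    obtain ⟨a, rfl⟩ := π.map_surjective (Y := X.as) a
    obtain ⟨b, rfl⟩ := π.map_surjective (Y := X.as) b
    rw [← π.map_comp, ← π.map_comp, π_eq, ← Preadditive.comp_sub] at hab
    exact (π_eq _ _).2 (SN.factorsThru_of_comp_left hNext hs hab)
  have := W.multiplicativeClosure_hasRightCalculusOfFractions hmono (by
    rintro _ _ Y' _ c ⟨hs⟩
    obtain ⟨c, rfl⟩ := π.map_surjective (X := Y'.as) c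
    obtain ⟨B, s', b, hs', h⟩ := SN.exists_ore hNsum hNext hs c
    exact ⟨π.obj B, π.map s', π.map b, .map hs', by
      rw [← π.map_comp, ← π.map_comp]
      exact (π_eq _ _).2 h⟩)
  let L := W.multiplicativeClosure.Q
  have hL : (SNProp N).IsInvertedBy (π ⋙ L) := fun _ _ s hs =>
    Localization.inverts L W.multiplicativeClosure _ (.of _ (.map hs))
  have hfL : L.map (π.map f) = L.map (π.map 0) := by
    have h₀ : Q.map f = Q.map 0 := by rw [hf, Q.map_zero]
    let e := Localization.fac (π ⋙ L) hL Q
    have he (g : X ⟶ Y) : L.map (π.map g) = e.inv.app X ≫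
        (Localization.lift (π ⋙ L) hL Q).map (Q.map g) ≫ e.hom.app Y :=
      (NatIso.naturality_1 e g).symm
    rw [he, he, h₀]
  obtain ⟨_, s, hs, h⟩ := (MorphismProperty.map_eq_iff_precomp L W.multiplicativeClosure _ _).1 hfL
  have : Epi s := ((MorphismProperty.multiplicativeClosure_le_iff W (.epimorphisms _)).2 hepi _ hs)
  simpa using (π_eq _ _).1 ((cancel_epi s).1 h)

open ZeroObject in
lemma map_eq_zero_of_factorsThru {N : Set C} (hN0 : ∀ X : C, IsZero X → X ∈ N)
    {D : Type u₂} [Category.{v₂} D] [Preadditive D]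
    (Q : C ⥤ D) [Q.Additive] [Q.IsLocalization (SNProp N)]
    {X Y : C} {f : X ⟶ Y} (hf : FactorsThru N f) : Q.map f = 0 := by
  obtain ⟨Z, hZ, u, v, rfl⟩ := hf
  have : IsIso (Q.map (0 : (0 : C) ⟶ Z)) :=
    Localization.inverts Q (SNProp N) _ (SN.zero_to hN0 hZ)
  have hQZ : IsZero (Q.obj Z) :=
    (Q.map_isZero (isZero_zero C)).of_iso (asIso (Q.map (0 : (0 : C) ⟶ Z))).symm
  rw [Q.map_comp, hQZ.eq_zero_of_tgt (Q.map u), zero_comp]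

theorem stmt8 (N : Set C)
    (hN0 : ∀ X : C, Limits.IsZero X → X ∈ N)
    (hNiso : ∀ ⦃X Y : C⦄, (X ≅ Y) → X ∈ N → Y ∈ N)
    (hNsum : ∀ ⦃X Z : C⦄ (i : X ⟶ Z) (r : Z ⟶ X), i ≫ r = 𝟙 X → Z ∈ N → X ∈ N)
    (hNext : ∀ (T : Triangle C), (T ∈ distTriang C) → T.obj₁ ∈ N → T.obj₃ ∈ N → T.obj₂ ∈ N)
    {D : Type u₂} [Category.{v₂} D] [Preadditive D] [HasZeroObject D]
    (Q : C ⥤ D) [Q.Additive] [Q.IsLocalization (SNProp N)]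
    {X Y : C} (f : X ⟶ Y) :
    Q.map f = 0 ↔ FactorsThru N f := by
  exact ⟨factorsThru_of_map_eq_zero hN0 hNsum hNext Q, map_eq_zero_of_factorsThru hN0 Q⟩
end
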